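/- Let X be a separable Banach space and let (T(t))_{t≥0} be a strongly continuous semigroup on X satisfying the hypercyclicity criterion. Then for every natural number n ≥ 1 the diagonal semigroup T^n(t) := T(t) × ⋯ × T(t) (n factors), acting on the product Banach space X^n equipped with the sup norm, also satisfies the hypercyclicity criterion. -/

import Mathlib

open Set Filter Topology TensorProduct

/-- A strongly continuous (C₀-) semigroup on a normed space. -/
def IsC0Semigroup {X : Type*} [NormedAddCommGroup X] [NormedSpace ℝ X]
    (T : ℝ → X →L[ℝ] X) : Prop :=
  T 0 = ContinuousLinearMap.id ℝ X ∧
  (∀ s t : ℝ, 0 ≤ s → 0 ≤ t → T (s + t) = (T s).comp (T t)) ∧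
  (∀ x : X, ContinuousOn (fun t => T t x) (Ici (0 : ℝ)))

/-- The semigroup is hypercyclic: some orbit `{T(t)x : t ≥ 0}` is dense. -/
def IsHypercyclicSg {X : Type*} [NormedAddCommGroup X] [NormedSpace ℝ X]
    (T : ℝ → X →L[ℝ] X) : Prop :=
  ∃ x : X, Dense {y : X | ∃ t : ℝ, 0 ≤ t ∧ T t x = y}

/-- The hypercyclicity criterion. -/
def SatisfiesHC {X : Type*} [NormedAddCommGroup X] [NormedSpace ℝ X]
    (T : ℝ → X →L[ℝ] X) : Prop :=
  ∀ U V W : Set X, IsOpen U → IsOpen V → IsOpen W →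
    U.Nonempty → V.Nonempty → (0 : X) ∈ W →
    ∃ t : ℝ, 0 < t ∧ (T t '' U ∩ W).Nonempty ∧ (T t '' W ∩ V).Nonempty

/-- The recurrent hypercyclicity criterion. -/
def SatisfiesRHC {X : Type*} [NormedAddCommGroup X] [NormedSpace ℝ X]
    (T : ℝ → X →L[ℝ] X) : Prop :=
  ∀ U V W : Set X, IsOpen U → IsOpen V → IsOpen W →
    U.Nonempty → V.Nonempty → (0 : X) ∈ W →
    ∃ L : ℝ, 0 ≤ L ∧ ∀ t : ℝ, 0 ≤ t → ∃ s ∈ Icc t (t + L),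
      (T s '' U ∩ W).Nonempty ∧ (T s '' W ∩ V).Nonempty

/-- The semigroup is chaotic: hypercyclic with a dense set of periodic points. -/
def IsChaoticSg {X : Type*} [NormedAddCommGroup X] [NormedSpace ℝ X]
    (T : ℝ → X →L[ℝ] X) : Prop :=
  (∃ x : X, Dense {y : X | ∃ t : ℝ, 0 ≤ t ∧ T t x = y}) ∧
  Dense {x : X | ∃ t : ℝ, 0 < t ∧ T t x = x}

/-- The diagonal semigroup `T(t) × ⋯ × T(t)` (n factors) acting on `Xⁿ` with the sup norm. -/
noncomputable def diagSg {X : Type*} [NormedAddCommGroup X] [NormedSpace ℝ X]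
    (T : ℝ → X →L[ℝ] X) (n : ℕ) : ℝ → (Fin n → X) →L[ℝ] (Fin n → X) :=
  fun t => ContinuousLinearMap.pi (fun i => (T t).comp (ContinuousLinearMap.proj i))

theorem SatisfiesHC.exists_image_inter_nonempty
    {X : Type*} [NormedAddCommGroup X] [NormedSpace ℝ X] {T : ℝ → X →L[ℝ] X}
    (hHC : SatisfiesHC T) {U V : Set X} (hU : IsOpen U) (hV : IsOpen V)
    (hUn : U.Nonempty) (hVn : V.Nonempty) :
    ∃ t : ℝ, 0 < t ∧ ∃ x ∈ U, T t x ∈ V := by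
  obtain ⟨x, hx⟩ := hUn
  obtain ⟨y, hy⟩ := hVn
  obtain ⟨r, hr, hrU⟩ := Metric.isOpen_iff.1 hU x hx
  obtain ⟨q, hq, hqV⟩ := Metric.isOpen_iff.1 hV y hy
  obtain ⟨t, ht, ⟨_, ⟨u, hu, rfl⟩, hTu⟩, ⟨_, ⟨w, hw, rfl⟩, hTw⟩⟩ :=
    hHC (Metric.ball x (r / 2)) (Metric.ball y (q / 2))
      (Metric.ball 0 (r / 2) ∩ Metric.ball 0 (q / 2))
      Metric.isOpen_ball Metric.isOpen_ball (Metric.isOpen_ball.inter Metric.isOpen_ball)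
      ⟨x, Metric.mem_ball_self (by positivity)⟩ ⟨y, Metric.mem_ball_self (by positivity)⟩
      ⟨Metric.mem_ball_self (by positivity), Metric.mem_ball_self (by positivity)⟩
  refine ⟨t, ht, u + w, hrU ?_, hqV ?_⟩
  · have h₁ := mem_ball_iff_norm.1 hu
    have h₂ := mem_ball_zero_iff.1 hw.1
    rw [mem_ball_iff_norm, add_sub_right_comm]
    linarith [norm_add_le (u - x) w]
  · have h₁ := mem_ball_zero_iff.1 hTu.2
    have h₂ := mem_ball_iff_norm.1 hTw
    rw [mem_ball_iff_norm, map_add, add_sub_assoc]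
    linarith [norm_add_le (T t u) (T t w - y)]

/-- Finitely many non-empty open sets can be visited, at suitable times, by all orbits starting in
a common non-empty open set. -/
theorem SatisfiesHC.exists_isOpen_mapsTo
    {X : Type*} [NormedAddCommGroup X] [NormedSpace ℝ X] {T : ℝ → X →L[ℝ] X}
    (hHC : SatisfiesHC T) {ι : Type*} (F : Finset ι) (U : ι → Set X)
    (hU : ∀ i, IsOpen (U i)) (hUn : ∀ i, (U i).Nonempty) :
    ∃ O : Set X, IsOpen O ∧ O.Nonempty ∧ ∀ i ∈ F, ∃ s : ℝ, 0 ≤ s ∧ MapsTo (T s) O (U i) := by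
  classical
  induction F using Finset.induction_on with
  | empty => exact ⟨univ, isOpen_univ, ⟨0, mem_univ 0⟩, by simp⟩
  | insert a F _ ih =>
    obtain ⟨O, hO, hOn, hF⟩ := ih
    obtain ⟨s, hs, x, hx, hTx⟩ := hHC.exists_image_inter_nonempty hO (hU a) hOn (hUn a)
    refine ⟨O ∩ T s ⁻¹' U a, hO.inter ((hU a).preimage (T s).continuous), ⟨x, hx, hTx⟩,
      fun i hi => ?_⟩
    rcases Finset.mem_insert.1 hi with rfl | hi
    · exact ⟨s, hs.le, fun _ h => h.2⟩
    · obtain ⟨q, hq, hm⟩ := hF i hi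
      exact ⟨q, hq, fun _ h => hm h.1⟩

theorem IsC0Semigroup.apply_comm
    {X : Type*} [NormedAddCommGroup X] [NormedSpace ℝ X] {T : ℝ → X →L[ℝ] X}
    (hT : IsC0Semigroup T) {s t : ℝ} (hs : 0 ≤ s) (ht : 0 ≤ t) (x : X) :
    T s (T t x) = T t (T s x) := by
  rw [← ContinuousLinearMap.comp_apply, ← hT.2.1 s t hs ht, add_comm, hT.2.1 t s ht hs,
    ContinuousLinearMap.comp_apply]

theorem diagonal_semigroup_satisfies_hypercyclicity_criterion
    {X : Type*} [NormedAddCommGroup X] [NormedSpace ℝ X] [CompleteSpace X]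
    [TopologicalSpace.SeparableSpace X]
    (T : ℝ → X →L[ℝ] X) (hT : IsC0Semigroup T) (hHC : SatisfiesHC T)
    (n : ℕ) (hn : 1 ≤ n) :
    SatisfiesHC (diagSg T n) := by
  intro U V W hU hV hW ⟨x, hx⟩ ⟨y, hy⟩ hW0
  obtain ⟨r, hr, hrU⟩ := Metric.isOpen_iff.1 hU x hx
  obtain ⟨q, hq, hqV⟩ := Metric.isOpen_iff.1 hV y hy
  obtain ⟨p, hp, hpW⟩ := Metric.isOpen_iff.1 hW 0 hW0
  obtain ⟨A, hA, hAn, hAU⟩ := hHC.exists_isOpen_mapsTo Finset.univ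
    (fun i => Metric.ball (x i) r) (fun _ => Metric.isOpen_ball)
    (fun i => ⟨x i, Metric.mem_ball_self hr⟩)
  obtain ⟨B, hB, hBn, hBV⟩ := hHC.exists_isOpen_mapsTo Finset.univ
    (fun i => Metric.ball (y i) q) (fun _ => Metric.isOpen_ball)
    (fun i => ⟨y i, Metric.mem_ball_self hq⟩)
  choose a ha hAm using fun i => hAU i (Finset.mem_univ i)
  choose b hb hBm using fun i => hBV i (Finset.mem_univ i)
  obtain ⟨t, ht, ⟨_, ⟨u, hu, rfl⟩, hTu⟩, ⟨_, ⟨w, hw, rfl⟩, hTw⟩⟩ :=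
    hHC A B ((⋂ i, T (a i) ⁻¹' Metric.ball 0 p) ∩ ⋂ i, T (b i) ⁻¹' Metric.ball 0 p) hA hB
      ((isOpen_iInter_of_finite fun i => Metric.isOpen_ball.preimage (T (a i)).continuous).inter
        (isOpen_iInter_of_finite fun i => Metric.isOpen_ball.preimage (T (b i)).continuous))
      hAn hBn (by simp [hp])
  refine ⟨t, ht, ⟨_, ⟨fun i => T (a i) u, hrU ?_, rfl⟩, hpW ?_⟩,
    ⟨_, ⟨fun i => T (b i) w, hpW ?_, rfl⟩, hqV ?_⟩⟩
  · rw [ball_pi _ hr]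
    exact fun i _ => hAm i hu
  · rw [ball_pi _ hp]
    intro i _
    change T t (T (a i) u) ∈ Metric.ball 0 p
    rw [hT.apply_comm ht.le (ha i)]
    exact mem_iInter.1 hTu.1 i
  · rw [ball_pi _ hp]
    exact fun i _ => mem_iInter.1 hw.2 i
  · rw [ball_pi _ hq]
    intro i _
    change T t (T (b i) w) ∈ Metric.ball (y i) q
    rw [hT.apply_comm ht.le (hb i)]
    exact hBm i hTw
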